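/- Let λ̃ be a maximizer over Δ of λ ↦ −h(λ) − w*ᵀ A R Rᵀ λ − γ_λ‖λ‖₁, where the sparse approximate solution λ* ∈ Δ satisfies the sub-optimality condition ‖∇h(λ*) + Aᵀ w*‖_∞ ≤ ς. Set ρ_λ = ‖(R Rᵀ − I) Aᵀ w*‖_∞ + ς. If γ_λ ≥ 2 ρ_λ, then ‖λ̃ − λ*‖₂ ≤ 3 γ_λ √s_λ / β, ‖λ̃ − λ*‖₁ ≤ 12 γ_λ s_λ / β, and ‖λ̃ − λ*‖₁ ≤ 4 √s_λ · ‖λ̃ − λ*‖₂. -/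

import Mathlib

open Matrix

/-- Euclidean (ℓ2) norm of a vector. -/
noncomputable def norm2 {k : ℕ} (x : Fin k → ℝ) : ℝ := Real.sqrt (∑ i, (x i) ^ 2)

/-- ℓ1 norm of a vector. -/
noncomputable def norm1 {k : ℕ} (x : Fin k → ℝ) : ℝ := ∑ i, |x i|

/-- ℓ∞ norm of a vector. -/
noncomputable def normInf {k : ℕ} (x : Fin k → ℝ) : ℝ := ⨆ i, |x i|

/-- Number of nonzero entries of a vector. -/
noncomputable def norm0 {k : ℕ} (x : Fin k → ℝ) : ℕ :=
  (Finset.univ.filter fun i => x i ≠ 0).card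

/-- `f` is `μ`-strongly convex with respect to the Euclidean norm. -/
def StronglyConvex {k : ℕ} (μ : ℝ) (f : (Fin k → ℝ) → ℝ) : Prop :=
  ∀ x y : Fin k → ℝ, ∀ t : ℝ, 0 ≤ t → t ≤ 1 →
    f (t • x + (1 - t) • y) ≤
      t * f x + (1 - t) * f y - μ / 2 * (t * (1 - t)) * (norm2 (x - y)) ^ 2

/-- `Df` is the gradient of `f` (w.r.t. the Euclidean inner product), characterized via
directional derivatives. -/
def IsGradient {k : ℕ} (f : (Fin k → ℝ) → ℝ) (Df : (Fin k → ℝ) → (Fin k → ℝ)) : Prop :=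
  ∀ x v : Fin k → ℝ, HasDerivAt (fun t : ℝ => f (x + t • v)) (Df x ⬝ᵥ v) 0

open Filter Topology

/-- Hölder's inequality for the pairing of ℓ∞ and ℓ1. -/
lemma abs_dotProduct_le_normInf_mul_norm1 {k : ℕ} (u v : Fin k → ℝ) :
    |u ⬝ᵥ v| ≤ normInf u * norm1 v := by
  unfold dotProduct normInf norm1
  rw [Finset.mul_sum]
  refine (Finset.abs_sum_le_sum_abs _ _).trans (Finset.sum_le_sum fun i _ => ?_)
  rw [abs_mul]
  exact mul_le_mul_of_nonneg_right
    (le_ciSup (f := fun i => |u i|) (Set.finite_range _).bddAbove i) (abs_nonneg _)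

/-- First-order lower bound for a strongly convex function. -/
lemma StronglyConvex.gradient_lower_bound {k : ℕ} {μ : ℝ} {f : (Fin k → ℝ) → ℝ}
    {Df : (Fin k → ℝ) → (Fin k → ℝ)} (hf : StronglyConvex μ f) (hDf : IsGradient f Df)
    (x y : Fin k → ℝ) :
    f y + Df y ⬝ᵥ (x - y) + μ / 2 * norm2 (x - y) ^ 2 ≤ f x := by
  have hslope := (hDf y (x - y)).tendsto_slope_zero_right
  have hbound : Tendsto (fun t : ℝ => f x - f y - μ / 2 * (1 - t) * norm2 (x - y) ^ 2)
      (𝓝[>] 0) (𝓝 (f x - f y - μ / 2 * (1 - 0) * norm2 (x - y) ^ 2)) :=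
    Continuous.tendsto (f := fun t : ℝ => f x - f y - μ / 2 * (1 - t) * norm2 (x - y) ^ 2)
      (by fun_prop) 0 |>.mono_left nhdsWithin_le_nhds
  have hle := le_of_tendsto_of_tendsto hslope hbound (by
    filter_upwards [Ioo_mem_nhdsGT (zero_lt_one' ℝ)] with t ht
    have hconv := hf x y t ht.1.le ht.2.le
    have hpoint : t • x + (1 - t) • y = y + t • (x - y) := by module
    rw [hpoint] at hconv
    simp only [zero_add, zero_smul, add_zero, smul_eq_mul]
    rw [inv_mul_le_iff₀ ht.1]
    linarith)
  linarith

/-- The ℓ1 norm over a set of coordinates is at most the square root of its size times the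
Euclidean norm. -/
lemma sum_abs_le_sqrt_card_mul_norm2 {k : ℕ} (s : Finset (Fin k)) (v : Fin k → ℝ) :
    ∑ i ∈ s, |v i| ≤ Real.sqrt s.card * norm2 v := by
  unfold norm2
  rw [← Real.sqrt_mul (Nat.cast_nonneg _)]
  apply Real.le_sqrt_of_sq_le
  refine sq_sum_le_card_mul_sum_sq.trans (mul_le_mul_of_nonneg_left ?_ (Nat.cast_nonneg _))
  simp only [sq_abs]
  exact Finset.sum_le_univ_sum_of_nonneg fun i => sq_nonneg _

/-- Decrease of the ℓ1 norm, split along the support of the base point. -/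
lemma norm1_sub_norm1_le {k : ℕ} (x y : Fin k → ℝ) :
    norm1 y - norm1 x ≤ 2 * (∑ i with y i ≠ 0, |(x - y) i|) - norm1 (x - y) := by
  unfold norm1
  rw [Finset.sum_filter, Finset.mul_sum, ← Finset.sum_sub_distrib, ← Finset.sum_sub_distrib]
  refine Finset.sum_le_sum fun i _ => ?_
  by_cases hy : y i = 0
  · simp [hy]
  · have := abs_sub_abs_le_abs_sub (y i) (x i)
    rw [abs_sub_comm] at this
    simp only [Pi.sub_apply, ne_eq, hy, not_false_eq_true, if_true]
    linarith

theorem dual_pseudo_solution_bound_suboptimal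
    {d n m : ℕ}
    (A : Matrix (Fin d) (Fin n) ℝ)
    (Δ : Set (Fin n → ℝ))
    (h : (Fin n → ℝ) → ℝ) (Dh : (Fin n → ℝ) → (Fin n → ℝ))
    (β γl ς : ℝ)
    (R : Matrix (Fin n) (Fin m) ℝ)
    (wstar : Fin d → ℝ) (lstar ltil : Fin n → ℝ)
    (hΔ : Convex ℝ Δ)
    (hβ : 0 < β) (hγl : 0 < γl) (hς : 0 < ς)
    (hh : StronglyConvex β h)
    (hDh : IsGradient h Dh)
    (hlΔ : lstar ∈ Δ) (hltilΔ : ltil ∈ Δ)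
    -- λ* satisfies the sub-optimality condition ‖∇h(λ*) + Aᵀw*‖_∞ ≤ ς
    (hsubopt : normInf (Dh lstar + Aᵀ *ᵥ wstar) ≤ ς)
    -- λ̃ maximizes λ ↦ −h(λ) − w*ᵀ A R Rᵀ λ − γ_λ‖λ‖₁ over Δ
    (hltil : ∀ lam ∈ Δ,
      -h lam - wstar ⬝ᵥ (A *ᵥ (R *ᵥ (Rᵀ *ᵥ lam))) - γl * norm1 lam
        ≤ -h ltil - wstar ⬝ᵥ (A *ᵥ (R *ᵥ (Rᵀ *ᵥ ltil))) - γl * norm1 ltil)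
    -- γ_λ ≥ 2 ρ_λ where ρ_λ = ‖(R Rᵀ − I) Aᵀ w*‖_∞ + ς
    (hγ : 2 * (normInf ((R * Rᵀ - 1) *ᵥ (Aᵀ *ᵥ wstar)) + ς) ≤ γl) :
    norm2 (ltil - lstar) ≤ 3 * γl * Real.sqrt (norm0 lstar) / β ∧
    norm1 (ltil - lstar) ≤ 12 * γl * (norm0 lstar : ℝ) / β ∧
    norm1 (ltil - lstar) ≤ 4 * Real.sqrt (norm0 lstar) * norm2 (ltil - lstar) := by
  set v := ltil - lstar with hv
  set S := ∑ i with lstar i ≠ 0, |v i|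
  set g := R *ᵥ (Rᵀ *ᵥ (Aᵀ *ᵥ wstar)) with hg
  have hpair : ∀ x, wstar ⬝ᵥ (A *ᵥ (R *ᵥ (Rᵀ *ᵥ x))) = g ⬝ᵥ x := by
    intro x
    simp only [hg, dotProduct_mulVec, ← mulVec_transpose, transpose_transpose]
  have hlower := hh.gradient_lower_bound hDh ltil lstar
  have hopt := hltil lstar hlΔ
  rw [hpair, hpair] at hopt
  have hsplit : Dh lstar ⬝ᵥ v + (g ⬝ᵥ ltil - g ⬝ᵥ lstar)
      = (Dh lstar + Aᵀ *ᵥ wstar) ⬝ᵥ v + ((R * Rᵀ - 1) *ᵥ (Aᵀ *ᵥ wstar)) ⬝ᵥ v := by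
    rw [sub_mulVec, one_mulVec, ← mulVec_mulVec, ← hg, ← dotProduct_sub, ← hv,
      ← add_dotProduct, ← add_dotProduct]
    congr 1
    abel
  have hgrad := neg_le_of_abs_le (abs_dotProduct_le_normInf_mul_norm1 (Dh lstar + Aᵀ *ᵥ wstar) v)
  have hproj := neg_le_of_abs_le
    (abs_dotProduct_le_normInf_mul_norm1 ((R * Rᵀ - 1) *ᵥ (Aᵀ *ᵥ wstar)) v)
  have hnorm1 : 0 ≤ norm1 v := Finset.sum_nonneg fun i _ => abs_nonneg _
  have hnorm2 : 0 ≤ norm2 v := Real.sqrt_nonneg _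
  have hρ : (normInf (Dh lstar + Aᵀ *ᵥ wstar) + normInf ((R * Rᵀ - 1) *ᵥ (Aᵀ *ᵥ wstar)))
      * norm1 v ≤ γl / 2 * norm1 v := mul_le_mul_of_nonneg_right (by linarith) hnorm1
  have hdecrease := mul_le_mul_of_nonneg_left (norm1_sub_norm1_le ltil lstar) hγl.le
  rw [← hv] at hlower hdecrease
  have hbasic : β / 2 * norm2 v ^ 2 ≤ γl * (2 * S - norm1 v / 2) := by linarith
  have hcone : norm1 v ≤ 4 * S := by
    have := nonneg_of_mul_nonneg_right ((by positivity : 0 ≤ β / 2 * norm2 v ^ 2).trans hbasic) hγl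
    linarith
  have hSle : S ≤ Real.sqrt (norm0 lstar) * norm2 v := sum_abs_le_sqrt_card_mul_norm2 _ v
  have hSnorm1 : S ≤ norm1 v := Finset.sum_le_univ_sum_of_nonneg fun i => abs_nonneg _
  have hl2 : norm2 v ≤ 3 * γl * Real.sqrt (norm0 lstar) / β := by
    rw [le_div_iff₀ hβ]
    rcases hnorm2.eq_or_lt with hzero | hpos
    · rw [← hzero]
      simp only [zero_mul]
      positivity
    · refine le_of_mul_le_mul_right ?_ hpos
      have := mul_le_mul_of_nonneg_left hSnorm1 hγl.le
      have := mul_le_mul_of_nonneg_left hSle hγl.le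
      linarith
  have hl1 : norm1 v ≤ 4 * Real.sqrt (norm0 lstar) * norm2 v := by linarith
  refine ⟨hl2, hl1.trans ?_, hl1⟩
  calc 4 * Real.sqrt (norm0 lstar) * norm2 v
      ≤ 4 * Real.sqrt (norm0 lstar) * (3 * γl * Real.sqrt (norm0 lstar) / β) := by gcongr
    _ = 12 * γl * (Real.sqrt (norm0 lstar) * Real.sqrt (norm0 lstar)) / β := by ring
    _ = 12 * γl * (norm0 lstar : ℝ) / β := by rw [Real.mul_self_sqrt (Nat.cast_nonneg _)]
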